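/- Interpolation estimates for the third-order expansion coefficients (estimate (5.12), part of Lemma 5.6 of the paper, in conditional form): Let α ∈ (0,1), let k ≥ 10 be an integer, and let C₀ > 0. Suppose v : ℝ^d × ℝ → ℝ is smooth and for every t ≥ 1 satisfies (i) sup_{Q_ρ(t)} |v| ≤ C₀ e^{−(6+α)t/2}, (ii) [𝔇^{10}v]_{α,Q_ρ(t)} ≤ C₀ e^{−t}, and (iii) [𝔇^ℓ v]_{α,Q_ρ(t)} ≤ C₀ e^{(ℓ−12)t/2} for every integer 10 ≤ ℓ ≤ 2k+12. Then there exists C > 0 such that for every t ≥ 1: sup_{Q_{ρ′}(t)} |𝔇^ℓ v| ≤ C e^{−(t/2)(6 + α − (4+α)ℓ/(10+α))} for every integer 0 ≤ ℓ ≤ 10, and sup_{Q_{ρ′}(t)} |𝔇^ℓ v| ≤ C e^{−(t/2)(6 + α − ℓ(ℓ−6+α)/(ℓ+α))} for every integer 10 ≤ ℓ ≤ 2k+12. -/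

import Mathlib

open Real Finset

/-- The `p`-th spatial Fréchet derivative of the `q`-th time derivative of
`u : ℝ^d × ℝ → ℝ` (space is the first variable, time the second). -/
noncomputable def spaceTimeDeriv (d : ℕ) (u : EuclideanSpace ℝ (Fin d) × ℝ → ℝ)
    (p q : ℕ) (x : EuclideanSpace ℝ (Fin d)) (s : ℝ) :
    ContinuousMultilinearMap ℝ (fun _ : Fin p => EuclideanSpace ℝ (Fin d)) ℝ :=
  iteratedFDeriv ℝ p (fun y => iteratedDeriv q (fun τ => u (y, τ)) s) x

/-- `|𝔇^k u (z)| = sqrt (Σ_{p+2q=k} ‖D_x^p ∂_t^q u(z)‖²)`. -/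
noncomputable def frakDNorm (d : ℕ) (u : EuclideanSpace ℝ (Fin d) × ℝ → ℝ)
    (k : ℕ) (z : EuclideanSpace ℝ (Fin d) × ℝ) : ℝ :=
  Real.sqrt (∑ q ∈ Finset.range (k / 2 + 1), ‖spaceTimeDeriv d u (k - 2 * q) q z.1 z.2‖ ^ 2)

/-- The parabolic cylinder `Q_ρ(t) = {(x,s) : |x| ≤ ρ, t-1 ≤ s ≤ t}`. -/
def parabolicCylinder (d : ℕ) (ρ t : ℝ) : Set (EuclideanSpace ℝ (Fin d) × ℝ) :=
  {z | ‖z.1‖ ≤ ρ ∧ t - 1 ≤ z.2 ∧ z.2 ≤ t}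

/-- The parabolic distance `|x-x'| + |s-s'|^{1/2}`. -/
noncomputable def parabolicDist (d : ℕ) (z w : EuclideanSpace ℝ (Fin d) × ℝ) : ℝ :=
  ‖z.1 - w.1‖ + |z.2 - w.2| ^ ((1 : ℝ) / 2)

/-- `[𝔇^k u]_{α,Q} ≤ B`: the sum over the components `D_x^{k-2q} ∂_t^q u` of their
parabolic `α`-Hölder seminorms over `Q` is at most `B`. -/
def frakDHolderLE (d : ℕ) (u : EuclideanSpace ℝ (Fin d) × ℝ → ℝ) (k : ℕ) (α : ℝ)
    (Q : Set (EuclideanSpace ℝ (Fin d) × ℝ)) (B : ℝ) : Prop :=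
  ∃ M : ℕ → ℝ, (∀ q, 0 ≤ M q) ∧ (∑ q ∈ Finset.range (k / 2 + 1), M q) ≤ B ∧
    ∀ q ∈ Finset.range (k / 2 + 1), ∀ z ∈ Q, ∀ w ∈ Q,
      ‖spaceTimeDeriv d u (k - 2 * q) q z.1 z.2 - spaceTimeDeriv d u (k - 2 * q) q w.1 w.2‖
        ≤ M q * parabolicDist d z w ^ α

open scoped ContDiff

section dirDeriv
variable {F : Type*} [NormedAddCommGroup F] [NormedSpace ℝ F]

/-- Iterated directional derivatives along a list of vectors. -/
noncomputable def dirD : List F → (F → ℝ) → F → ℝ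
  | [], f => f
  | w :: L, f => dirD L (fun z => fderiv ℝ f z w)

/-- Iterated finite differences along a list of vectors. -/
def finD : List F → (F → ℝ) → F → ℝ
  | [], f => f
  | w :: L, f => fun z => finD L f (z + w) - finD L f z

/-- The zonotope spanned by a list of vectors. -/
def zBox : List F → Set F
  | [] => {0}
  | w :: L => {e | ∃ θ : ℝ, 0 ≤ θ ∧ θ ≤ 1 ∧ ∃ e' ∈ zBox L, e = θ • w + e'}

theorem contDiff_dir {f : F → ℝ} (hf : ContDiff ℝ ∞ f) (w : F) :
    ContDiff ℝ ∞ (fun z => fderiv ℝ f z w) :=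
  (hf.fderiv_right (m := ∞) (by simp)).clm_apply contDiff_const

theorem contDiff_dirD (L : List F) {f : F → ℝ} (hf : ContDiff ℝ ∞ f) :
    ContDiff ℝ ∞ (dirD L f) := by
  induction L generalizing f with
  | nil => exact hf
  | cons w L ih => exact ih (contDiff_dir hf w)

theorem contDiff_finD (L : List F) {f : F → ℝ} (hf : ContDiff ℝ ∞ f) :
    ContDiff ℝ ∞ (finD L f) := by
  induction L generalizing f with
  | nil => exact hf
  | cons w L ih =>
    exact ((ih hf).comp (contDiff_id.add contDiff_const)).sub (ih hf)

theorem fderiv_finD (L : List F) {f : F → ℝ} (hf : ContDiff ℝ ∞ f) (w z : F) :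
    fderiv ℝ (finD L f) z w = finD L (fun y => fderiv ℝ f y w) z := by
  induction L generalizing z with
  | nil => rfl
  | cons v L ih =>
    have hd : Differentiable ℝ (finD L f) := (contDiff_finD L hf).differentiable (by simp)
    have h2 : DifferentiableAt ℝ (fun y => finD L f (y + v)) z :=
      (hd (z + v)).comp z (differentiableAt_id.add_const v)
    simp only [finD]
    rw [fderiv_fun_sub h2 (hd z), fderiv_comp_add_right]
    simp [ih]

theorem abs_finD_le (L : List F) (f : F → ℝ) (z : F) (A : ℝ)
    (h : ∀ e ∈ zBox L, |f (z + e)| ≤ A) : |finD L f z| ≤ 2 ^ L.length * A := by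
  induction L generalizing z with
  | nil => simpa [finD] using h 0 (by simp [zBox])
  | cons w L ih =>
    have a1 := ih (z + w) (fun e he => by
      have := h (w + e) ⟨1, by norm_num, by norm_num, e, he, by simp⟩
      rwa [add_assoc])
    have a2 := ih z (fun e he => h e ⟨0, by norm_num, by norm_num, e, he, by simp⟩)
    have := abs_sub (finD L f (z + w)) (finD L f z)
    simp only [finD, List.length_cons, pow_succ]
    linarith

theorem finD_mvt (L : List F) {f : F → ℝ} (hf : ContDiff ℝ ∞ f) (z : F) :
    ∃ e ∈ zBox L, finD L f z = dirD L f (z + e) := by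
  induction L generalizing f z with
  | nil => exact ⟨0, by simp [zBox], by simp [finD, dirD]⟩
  | cons w L ih =>
    have hd : Differentiable ℝ (finD L f) := (contDiff_finD L hf).differentiable (by simp)
    have hder : ∀ θ : ℝ, HasDerivAt (fun θ : ℝ => finD L f (z + θ • w))
        (fderiv ℝ (finD L f) (z + θ • w) w) θ := by
      intro θ
      have h1 : HasDerivAt (fun θ : ℝ => z + θ • w) w θ := by
        simpa using ((hasDerivAt_id θ).smul_const w).const_add z
      exact (hd (z + θ • w)).hasFDerivAt.comp_hasDerivAt θ h1
    obtain ⟨θ, hθ, hs⟩ := exists_hasDerivAt_eq_slope (fun θ : ℝ => finD L f (z + θ • w)) _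
      (zero_lt_one) (fun θ _ => (hder θ).continuousAt.continuousWithinAt) (fun θ _ => hder θ)
    rw [fderiv_finD L hf] at hs
    obtain ⟨e, he, h⟩ := ih (contDiff_dir hf w) (z + θ • w)
    refine ⟨θ • w + e, ⟨θ, hθ.1.le, hθ.2.le, e, he, rfl⟩, ?_⟩
    simp only [finD, dirD, ← add_assoc]
    rw [← h, hs]
    simp

theorem dirD_append (L₁ L₂ : List F) (f : F → ℝ) :
    dirD (L₁ ++ L₂) f = dirD L₂ (dirD L₁ f) := by
  induction L₁ generalizing f with
  | nil => rfl
  | cons w L ih => exact ih _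

theorem exists_dirD_le (L : List F) {f : F → ℝ} (hf : ContDiff ℝ ∞ f) (z : F) (A : ℝ)
    (h : ∀ e ∈ zBox L, |f (z + e)| ≤ A) :
    ∃ e ∈ zBox L, |dirD L f (z + e)| ≤ 2 ^ L.length * A := by
  obtain ⟨e, he, h'⟩ := finD_mvt L hf z
  exact ⟨e, he, h' ▸ abs_finD_le L f z A h⟩

end dirDeriv

section prod
variable {E : Type*} [NormedAddCommGroup E] [NormedSpace ℝ E]

theorem zBox_bound (L : List (E × ℝ)) (a b σ : ℝ)
    (h : ∀ w ∈ L, ‖w.1‖ ≤ a ∧ 0 ≤ σ * w.2 ∧ σ * w.2 ≤ b) (e : E × ℝ) (he : e ∈ zBox L) :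
    ‖e.1‖ ≤ L.length * a ∧ 0 ≤ σ * e.2 ∧ σ * e.2 ≤ L.length * b := by
  induction L generalizing e with
  | nil => simp only [zBox, Set.mem_singleton_iff] at he; subst he; simp
  | cons w L ih =>
    obtain ⟨θ, h0, h1, e', he', rfl⟩ := he
    obtain ⟨i1, i2, i3⟩ := ih (fun w hw => h w (by simp [hw])) e' he'
    obtain ⟨j1, j2, j3⟩ := h w (by simp)
    simp only [Prod.fst_add, Prod.smul_fst, Prod.snd_add, Prod.smul_snd, smul_eq_mul,
      List.length_cons, Nat.cast_add, Nat.cast_one]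
    refine ⟨?_, ?_, ?_⟩
    · have := norm_add_le (θ • w.1) e'.1
      rw [norm_smul, Real.norm_of_nonneg h0] at this
      have := mul_le_of_le_one_left (norm_nonneg w.1) h1
      linarith
    · have := mul_nonneg h0 j2
      linarith
    · have := mul_le_of_le_one_left j2 h1
      linarith

/-- The list of purely spatial vectors attached to a tuple. -/
def spL : (p : ℕ) → (Fin p → E) → List (E × ℝ)
  | 0, _ => []
  | p + 1, m => (m (Fin.last p), (0 : ℝ)) :: spL p (Fin.init m)

theorem spL_length (p : ℕ) (m : Fin p → E) : (spL p m).length = p := by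
  induction p with
  | zero => rfl
  | succ p ih => simp [spL, ih]

theorem spL_mem (p : ℕ) (m : Fin p → E) (w : E × ℝ) (hw : w ∈ spL p m) :
    ∃ i, w = (m i, 0) := by
  induction p with
  | zero => simp [spL] at hw
  | succ p ih =>
    simp only [spL, List.mem_cons] at hw
    rcases hw with h | h
    · exact ⟨_, h⟩
    · obtain ⟨i, hi⟩ := ih _ h
      exact ⟨i.castSucc, hi⟩

theorem contDiff_slice {f : E × ℝ → ℝ} (hf : ContDiff ℝ ∞ f) (s : ℝ) :
    ContDiff ℝ ∞ (fun y => f (y, s)) := hf.comp (contDiff_id.prodMk contDiff_const)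

theorem contDiff_tslice {f : E × ℝ → ℝ} (hf : ContDiff ℝ ∞ f) (x : E) :
    ContDiff ℝ ∞ (fun s => f (x, s)) := hf.comp (contDiff_const.prodMk contDiff_id)

theorem dirD_spL (p : ℕ) (m : Fin p → E) {f : E × ℝ → ℝ} (hf : ContDiff ℝ ∞ f) (x : E) (s : ℝ) :
    dirD (spL p m) f (x, s) = iteratedFDeriv ℝ p (fun y => f (y, s)) x m := by
  induction p generalizing f with
  | zero => simp [spL, dirD]
  | succ p ih =>
    simp only [spL, dirD]
    rw [ih _ (contDiff_dir hf _), iteratedFDeriv_succ_apply_right]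
    have hs := contDiff_slice hf s
    have h1 : (fun y => fderiv ℝ f (y, s) (m (Fin.last p), (0:ℝ))) =
        (ContinuousLinearMap.apply ℝ ℝ (m (Fin.last p))) ∘ (fderiv ℝ (fun y => f (y, s))) := by
      funext y
      have hy : HasFDerivAt (fun y => f (y, s)) ((fderiv ℝ f (y, s)).comp
          (ContinuousLinearMap.inl ℝ E ℝ)) y :=
        ((hf.differentiable (by simp)) (y, s)).hasFDerivAt.comp y (hasFDerivAt_prodMk_left y s)
      simp [hy.fderiv]
    rw [h1, ContinuousLinearMap.iteratedFDeriv_comp_left _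
      ((hs.fderiv_right (m := ∞) (by simp)).contDiffAt) (by exact_mod_cast le_top)]
    rfl

theorem dirD_time (q : ℕ) (τ : ℝ) {f : E × ℝ → ℝ} (hf : ContDiff ℝ ∞ f) (x : E) (s : ℝ) :
    dirD (List.replicate q ((0 : E), τ)) f (x, s) =
      τ ^ q * iteratedDeriv q (fun s => f (x, s)) s := by
  induction q generalizing f with
  | zero => simp [dirD]
  | succ q ih =>
    simp only [List.replicate_succ, dirD]
    rw [ih (contDiff_dir hf _), iteratedDeriv_succ']
    have h1 : (fun s => fderiv ℝ f (x, s) ((0 : E), τ)) =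
        fun s => τ * deriv (fun s => f (x, s)) s := by
      funext y
      have hy : HasDerivAt (fun s => f (x, s)) (fderiv ℝ f (x, y) ((0 : E), (1:ℝ))) y :=
        ((hf.differentiable (by simp)) (x, y)).hasFDerivAt.comp_hasDerivAt y
          ((hasDerivAt_const y x).prodMk (hasDerivAt_id y))
      rw [hy.deriv, ← smul_eq_mul, ← map_smul]
      simp
    rw [h1, iteratedDeriv_const_mul_field, pow_succ]
    ring

end prod

theorem dirD_spaceTime (d p q : ℕ) (τ : ℝ) (w : Fin p → EuclideanSpace ℝ (Fin d))
    {u : EuclideanSpace ℝ (Fin d) × ℝ → ℝ} (hu : ContDiff ℝ ∞ u)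
    (x : EuclideanSpace ℝ (Fin d)) (s : ℝ) :
    dirD (List.replicate q ((0 : EuclideanSpace ℝ (Fin d)), τ) ++ spL p w) u (x, s) =
      τ ^ q * spaceTimeDeriv d u p q x s w := by
  rw [dirD_append, dirD_spL p w (contDiff_dirD _ hu), spaceTimeDeriv]
  have h1 : (fun y => dirD (List.replicate q ((0 : EuclideanSpace ℝ (Fin d)), τ)) u (y, s)) =
      (τ ^ q) • (fun y => iteratedDeriv q (fun s => u (y, s)) s) := by
    funext y
    rw [dirD_time q τ hu]; rfl
  have h2 : (fun y => iteratedDeriv q (fun s => u (y, s)) s) =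
      (fun y => dirD (List.replicate q ((0 : EuclideanSpace ℝ (Fin d)), 1)) u (y, s)) := by
    funext y
    rw [dirD_time q 1 hu]; simp
  have h3 : ContDiff ℝ ∞ (fun y => iteratedDeriv q (fun s => u (y, s)) s) := by
    rw [h2]; exact contDiff_slice (contDiff_dirD _ hu) s
  rw [h1, iteratedFDeriv_const_smul_apply (h3.contDiffAt.of_le (by exact_mod_cast le_top))]
  rfl

/-- The `q`-th time derivative as a function on space-time. -/
noncomputable def timeD (d : ℕ) (u : EuclideanSpace ℝ (Fin d) × ℝ → ℝ) (q : ℕ) :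
    EuclideanSpace ℝ (Fin d) × ℝ → ℝ :=
  fun z => iteratedDeriv q (fun τ => u (z.1, τ)) z.2

theorem contDiff_timeD (d q : ℕ) {u : EuclideanSpace ℝ (Fin d) × ℝ → ℝ} (hu : ContDiff ℝ ∞ u) :
    ContDiff ℝ ∞ (timeD d u q) := by
  have : timeD d u q = dirD (List.replicate q ((0 : EuclideanSpace ℝ (Fin d)), 1)) u := by
    funext z
    rcases z with ⟨x, s⟩
    rw [dirD_time q 1 hu]; simp [timeD]
  rw [this]; exact contDiff_dirD _ hu

theorem spaceTimeDeriv_timeD (d p q : ℕ) (u : EuclideanSpace ℝ (Fin d) × ℝ → ℝ) :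
    spaceTimeDeriv d (timeD d u q) p 0 = spaceTimeDeriv d u p q := by
  funext x s
  simp [spaceTimeDeriv, timeD]

theorem norm_spaceTimeDeriv_zero (d q : ℕ) (u : EuclideanSpace ℝ (Fin d) × ℝ → ℝ)
    (x : EuclideanSpace ℝ (Fin d)) (s : ℝ) :
    ‖spaceTimeDeriv d u 0 q x s‖ = |timeD d u q (x, s)| := by
  simp [spaceTimeDeriv, timeD]

theorem opNorm_le_unit (d p : ℕ)
    (f : ContinuousMultilinearMap ℝ (fun _ : Fin p => EuclideanSpace ℝ (Fin d)) ℝ) (K : ℝ)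
    (h : ∀ v : Fin p → EuclideanSpace ℝ (Fin d), (∀ i, ‖v i‖ ≤ 1) → |f v| ≤ K) : ‖f‖ ≤ K := by
  have hK : 0 ≤ K := (abs_nonneg _).trans (h (fun _ => 0) (by simp))
  refine ContinuousMultilinearMap.opNorm_le_bound hK (fun m => ?_)
  have h1 := h (fun i => ‖m i‖⁻¹ • m i) (fun i => by
    rw [norm_smul, norm_inv, norm_norm]; exact inv_mul_le_one)
  have h2 : f m = (∏ i, ‖m i‖) • f (fun i => ‖m i‖⁻¹ • m i) := by
    rw [← f.map_smul_univ]
    congr 1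
    funext i
    by_cases hm : m i = 0
    · simp [hm]
    · rw [smul_smul, mul_inv_cancel₀ (by simpa using hm), one_smul]
  rw [h2, norm_smul, Real.norm_of_nonneg (Finset.prod_nonneg (fun i _ => norm_nonneg _)),
    Real.norm_eq_abs, mul_comm]
  exact mul_le_mul_of_nonneg_right h1 (Finset.prod_nonneg (fun i _ => norm_nonneg _))

theorem key_point (d p q : ℕ) (r' r : ℝ) (hr : r' < r) :
    ∃ K > 0, ∀ u : EuclideanSpace ℝ (Fin d) × ℝ → ℝ, ContDiff ℝ ∞ u → ∀ t δ A : ℝ,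
      0 < δ → δ ≤ 1 → (∀ z ∈ parabolicCylinder d r t, |u z| ≤ A) →
      ∀ x₀ s₀, (x₀, s₀) ∈ parabolicCylinder d r' t →
      ∀ v : Fin p → EuclideanSpace ℝ (Fin d), (∀ i, ‖v i‖ ≤ 1) →
      ∃ x s, (x, s) ∈ parabolicCylinder d r t ∧ ‖x - x₀‖ ≤ (r - r') * δ ∧ |s - s₀| ≤ δ ^ 2 ∧
        |spaceTimeDeriv d u p q x s v| ≤ K * A / δ ^ (p + 2 * q) ∧
        (q = 0 → s = s₀) ∧ (p = 0 → x = x₀) := by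
  set N : ℝ := (p : ℝ) + q with hN
  have hN0 : 0 ≤ N := by positivity
  set c : ℝ := min (r - r') (1 / 2) / (N + 1) with hc
  have hm0 : 0 < min (r - r') (1 / 2) := lt_min (by linarith) (by norm_num)
  have hc0 : 0 < c := by positivity
  have hNc : N * c ≤ min (r - r') (1 / 2) := by
    rw [hc, mul_div_assoc', div_le_iff₀ (by positivity)]
    nlinarith
  have hNc1 : N * c ≤ r - r' := hNc.trans (min_le_left _ _)
  have hNc2 : N * c ≤ 1 / 2 := hNc.trans (min_le_right _ _)
  refine ⟨2 ^ (p + q) / c ^ (p + q), by positivity, ?_⟩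
  intro u hu t δ A hδ0 hδ1 hA x₀ s₀ hz v hv
  obtain ⟨hz1, hz2, hz3⟩ := hz
  simp only at hz1 hz2 hz3
  obtain ⟨σ, hσ, hσd⟩ : ∃ σ : ℝ, (σ = 1 ∨ σ = -1) ∧
      ∀ b : ℝ, 0 ≤ σ * b → σ * b ≤ 1 / 2 → t - 1 ≤ s₀ + b ∧ s₀ + b ≤ t := by
    by_cases h : s₀ ≤ t - 1 / 2
    · exact ⟨1, Or.inl rfl, fun b h1 h2 => ⟨by linarith, by linarith⟩⟩
    · push Not at h
      exact ⟨-1, Or.inr rfl, fun b h1 h2 => ⟨by linarith, by linarith⟩⟩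
  have hσ2 : σ * σ = 1 := by rcases hσ with h | h <;> rw [h] <;> norm_num
  have hσa : |σ| = 1 := by rcases hσ with h | h <;> rw [h] <;> norm_num
  have hδ2 : δ ^ 2 ≤ 1 := pow_le_one₀ hδ0.le hδ1
  set τ : ℝ := σ * (c * δ ^ 2) with hτ
  have hστ : σ * τ = c * δ ^ 2 := by rw [hτ, ← mul_assoc, hσ2, one_mul]
  set L : List (EuclideanSpace ℝ (Fin d) × ℝ) :=
    List.replicate q ((0 : EuclideanSpace ℝ (Fin d)), τ) ++ spL p (fun i => (c * δ) • v i) with hL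
  have hlen : L.length = p + q := by simp [hL, spL_length, add_comm]
  have hlen' : (L.length : ℝ) = N := by rw [hlen]; push_cast; rfl
  have hmem : ∀ w ∈ L, (w = (0, τ) ∧ q ≠ 0) ∨ (‖w.1‖ ≤ c * δ ∧ w.2 = 0 ∧ p ≠ 0) := by
    intro w hw
    rw [hL, List.mem_append] at hw
    rcases hw with hw | hw
    · rw [List.mem_replicate] at hw
      exact Or.inl ⟨hw.2, hw.1⟩
    · obtain ⟨i, hi⟩ := spL_mem _ _ _ hw
      refine Or.inr ⟨?_, by rw [hi], fun h => by subst h; exact i.elim0⟩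
      rw [hi]
      simp only [norm_smul, Real.norm_of_nonneg (mul_pos hc0 hδ0).le]
      exact mul_le_of_le_one_right (mul_pos hc0 hδ0).le (hv i)
  have hbox := zBox_bound L (c * δ) (c * δ ^ 2) σ (by
    intro w hw
    rcases hmem w hw with ⟨h, _⟩ | ⟨h1, h2, _⟩
    · rw [h]
      simp only [norm_zero, hστ]
      exact ⟨by positivity, by positivity, le_rfl⟩
    · rw [h2, mul_zero]
      exact ⟨h1, le_rfl, by positivity⟩)
  rw [hlen'] at hbox
  have hbd : ∀ e ∈ zBox L, ‖e.1‖ ≤ (r - r') * δ ∧ 0 ≤ σ * e.2 ∧ σ * e.2 ≤ 1 / 2 * δ ^ 2 := by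
    intro e he
    obtain ⟨a1, a2, a3⟩ := hbox e he
    refine ⟨a1.trans ?_, a2, a3.trans ?_⟩
    · rw [← mul_assoc]; exact mul_le_mul_of_nonneg_right hNc1 hδ0.le
    · rw [← mul_assoc]; exact mul_le_mul_of_nonneg_right hNc2 (by positivity)
  have hin : ∀ e ∈ zBox L, (x₀, s₀) + e ∈ parabolicCylinder d r t := by
    intro e he
    obtain ⟨a1, a2, a3⟩ := hbd e he
    obtain ⟨b1, b2⟩ := hσd e.2 a2 (by linarith)
    refine ⟨?_, b1, b2⟩
    have := norm_add_le x₀ e.1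
    have : (r - r') * δ ≤ (r - r') := mul_le_of_le_one_right (by linarith) hδ1
    simp only [Prod.fst_add]
    linarith
  obtain ⟨e, he, hle⟩ := exists_dirD_le L hu (x₀, s₀) A (fun e he => hA _ (hin e he))
  obtain ⟨a1, a2, a3⟩ := hbd e he
  refine ⟨x₀ + e.1, s₀ + e.2, hin e he, by simpa using a1, ?_, ?_, ?_, ?_⟩
  · have : |e.2| = |σ * e.2| := by rw [abs_mul, hσa, one_mul]
    rw [add_sub_cancel_left, this, abs_of_nonneg a2]
    nlinarith [sq_nonneg δ]
  · have : ((x₀, s₀) + e : EuclideanSpace ℝ (Fin d) × ℝ) = (x₀ + e.1, s₀ + e.2) := rfl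
    rw [this, hL, dirD_spaceTime d p q τ _ hu, ← hL, hlen] at hle
    have hsm := (spaceTimeDeriv d u p q (x₀ + e.1) (s₀ + e.2)).map_smul_univ
      (fun _ => c * δ) v
    rw [hsm] at hle
    simp only [Finset.prod_const, Finset.card_univ, Fintype.card_fin, smul_eq_mul] at hle
    rw [abs_mul, abs_mul, hτ, abs_pow, abs_mul, hσa, one_mul,
      abs_of_nonneg (by positivity : 0 ≤ c * δ ^ 2),
      abs_of_nonneg (by positivity : 0 ≤ (c * δ) ^ p)] at hle
    rw [le_div_iff₀ (by positivity), div_mul_eq_mul_div, le_div_iff₀ (by positivity)]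
    calc _ = (c * δ ^ 2) ^ q * ((c * δ) ^ p *
        |(spaceTimeDeriv d u p q (x₀ + e.1) (s₀ + e.2)) v|) := by
          rw [mul_pow, mul_pow, ← pow_mul, pow_add, pow_add]; ring
      _ ≤ _ := hle
  · intro hq
    have := zBox_bound L (c * δ) 0 1 (by
      intro w hw
      rcases hmem w hw with ⟨h, h'⟩ | ⟨h1, h2, _⟩
      · exact absurd hq h'
      · rw [h2]; simpa using h1) e he
    have h0 : e.2 = 0 := by linarith [this.2.1, this.2.2]
    rw [h0, add_zero]
  · intro hp
    have := zBox_bound L 0 (c * δ ^ 2) σ (by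
      intro w hw
      rcases hmem w hw with ⟨h, h'⟩ | ⟨h1, h2, h'⟩
      · rw [h]
        simp only [norm_zero, hστ]
        exact ⟨le_rfl, by positivity, le_rfl⟩
      · exact absurd hp h') e he
    have h0 : e.1 = 0 := by
      have := this.1
      rw [mul_zero] at this
      exact norm_le_zero_iff.mp this
    rw [h0, add_zero]

/-- Scale-invariant bound on `D_x^p ∂_t^q u` over all cylinders of radius `r`. -/
def IntB (d : ℕ) (u : EuclideanSpace ℝ (Fin d) × ℝ → ℝ) (A δ : ℝ → ℝ) (r : ℝ) (p q : ℕ) : Prop :=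
  ∃ K > 0, ∀ t ≥ (1 : ℝ), ∀ z ∈ parabolicCylinder d r t,
    ‖spaceTimeDeriv d u p q z.1 z.2‖ ≤ K * A t / δ t ^ (p + 2 * q)

theorem step_top (d p q : ℕ) (r' r α : ℝ) (hr : r' < r) (hα : 0 < α)
    (u : EuclideanSpace ℝ (Fin d) × ℝ → ℝ) (hu : ContDiff ℝ ∞ u) (A δ : ℝ → ℝ)
    (hA0 : ∀ t ≥ (1 : ℝ), 0 < A t)
    (hδ0 : ∀ t ≥ (1 : ℝ), 0 < δ t) (hδ1 : ∀ t ≥ (1 : ℝ), δ t ≤ 1)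
    (hA : ∀ t ≥ (1 : ℝ), ∀ z ∈ parabolicCylinder d r t, |u z| ≤ A t)
    (hH : ∀ t ≥ (1 : ℝ), ∀ z ∈ parabolicCylinder d r t, ∀ w ∈ parabolicCylinder d r t,
      ‖spaceTimeDeriv d u p q z.1 z.2 - spaceTimeDeriv d u p q w.1 w.2‖ ≤
        A t / δ t ^ (p + 2 * q) / δ t ^ α * parabolicDist d z w ^ α) :
    IntB d u A δ r' p q := by
  obtain ⟨K, hK, key⟩ := key_point d p q r' r hr
  have hR : 0 < r - r' + 1 := by linarith
  refine ⟨K + (r - r' + 1) ^ α, by positivity, ?_⟩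
  intro t ht z hz
  have hδ := hδ0 t ht
  have hAt := hA0 t ht
  refine opNorm_le_unit d p _ _ (fun v hv => ?_)
  obtain ⟨x, s, hxs, h1, h2, h3, -, -⟩ := key u hu t (δ t) (A t) hδ (hδ1 t ht) (hA t ht) z.1 z.2 hz v hv
  have hzr : z ∈ parabolicCylinder d r t := ⟨hz.1.trans hr.le, hz.2.1, hz.2.2⟩
  have h4 := hH t ht z hzr (x, s) hxs
  have hd : parabolicDist d z (x, s) ≤ (r - r' + 1) * δ t := by
    simp only [parabolicDist]
    have : |z.2 - s| ^ ((1 : ℝ) / 2) ≤ δ t := by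
      rw [← Real.sqrt_eq_rpow, abs_sub_comm]
      exact Real.sqrt_le_iff.mpr ⟨hδ.le, h2⟩
    rw [norm_sub_rev]
    linarith
  have hd0 : 0 ≤ parabolicDist d z (x, s) := by
    simp only [parabolicDist]; positivity
  have h5 : parabolicDist d z (x, s) ^ α ≤ (r - r' + 1) ^ α * δ t ^ α := by
    rw [← Real.mul_rpow hR.le hδ.le]
    exact Real.rpow_le_rpow hd0 hd hα.le
  have hδα : 0 < δ t ^ α := Real.rpow_pos_of_pos hδ α
  have h6 : A t / δ t ^ (p + 2 * q) / δ t ^ α * parabolicDist d z (x, s) ^ α ≤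
      (r - r' + 1) ^ α * A t / δ t ^ (p + 2 * q) := by
    calc _ ≤ A t / δ t ^ (p + 2 * q) / δ t ^ α * ((r - r' + 1) ^ α * δ t ^ α) :=
          mul_le_mul_of_nonneg_left h5 (by positivity)
      _ = _ := by field_simp
  have h7 : |(spaceTimeDeriv d u p q z.1 z.2 - spaceTimeDeriv d u p q x s) v| ≤
      ‖spaceTimeDeriv d u p q z.1 z.2 - spaceTimeDeriv d u p q x s‖ := by
    refine ((spaceTimeDeriv d u p q z.1 z.2 - spaceTimeDeriv d u p q x s).le_opNorm v).trans ?_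
    exact mul_le_of_le_one_right (norm_nonneg _)
      (Finset.prod_le_one (fun i _ => norm_nonneg _) (fun i _ => hv i))
  rw [ContinuousMultilinearMap.sub_apply] at h7
  have h8 := abs_sub_abs_le_abs_sub (spaceTimeDeriv d u p q z.1 z.2 v)
    (spaceTimeDeriv d u p q x s v)
  have h9 : (K + (r - r' + 1) ^ α) * A t / δ t ^ (p + 2 * q) =
    K * A t / δ t ^ (p + 2 * q) + (r - r' + 1) ^ α * A t / δ t ^ (p + 2 * q) := by ring
  rw [h9]
  simp only at h4
  linarith

theorem step_time (d q : ℕ) (r' r : ℝ) (hr : r' < r)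
    (u : EuclideanSpace ℝ (Fin d) × ℝ → ℝ) (hu : ContDiff ℝ ∞ u) (A δ : ℝ → ℝ)
    (hδ0 : ∀ t ≥ (1 : ℝ), 0 < δ t) (hδ1 : ∀ t ≥ (1 : ℝ), δ t ≤ 1)
    (hA : ∀ t ≥ (1 : ℝ), ∀ z ∈ parabolicCylinder d r t, |u z| ≤ A t)
    (hB : IntB d u A δ r' 0 (q + 1)) :
    IntB d u A δ r' 0 q := by
  obtain ⟨K, hK, key⟩ := key_point d 0 q r' r hr
  obtain ⟨K₁, hK₁, hB⟩ := hB
  refine ⟨K + K₁, by positivity, ?_⟩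
  rintro t ht ⟨x₀, s₀⟩ hz
  have hδ := hδ0 t ht
  obtain ⟨x, s, hxs, h1, h2, h3, -, hx⟩ :=
    key u hu t (δ t) (A t) hδ (hδ1 t ht) (hA t ht) x₀ s₀ hz 0 (by simp)
  have hx := hx rfl
  subst hx
  have hd : ∀ σ : ℝ, HasDerivAt (fun σ => timeD d u q (x, σ)) (timeD d u (q + 1) (x, σ)) σ := by
    intro σ
    have h : Differentiable ℝ (fun σ => timeD d u q (x, σ)) :=
      (contDiff_tslice (contDiff_timeD d q hu) x).differentiable (by simp)
    have h' := (h σ).hasDerivAt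
    have e : timeD d u (q + 1) (x, σ) = deriv (fun σ => timeD d u q (x, σ)) σ := by
      simp only [timeD, iteratedDeriv_succ]
    rw [e]; exact h'
  have hm := Convex.norm_image_sub_le_of_norm_deriv_le (s := Set.Icc (t - 1) t) (x := s) (y := s₀)
    (f := fun σ => timeD d u q (x, σ)) (C := K₁ * A t / δ t ^ (0 + 2 * (q + 1)))
    (fun σ _ => (hd σ).differentiableAt) (fun σ hσ => by
      rw [(hd σ).deriv, Real.norm_eq_abs, ← norm_spaceTimeDeriv_zero]
      exact hB t ht (x, σ) ⟨hz.1, hσ.1, hσ.2⟩) (convex_Icc _ _) ⟨hxs.2.1, hxs.2.2⟩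
    ⟨hz.2.1, hz.2.2⟩
  simp only [Real.norm_eq_abs] at hm
  rw [norm_spaceTimeDeriv_zero]
  have h3' : |timeD d u q (x, s)| ≤ K * A t / δ t ^ (0 + 2 * q) := by
    simpa [spaceTimeDeriv, timeD] using h3
  have hnn : 0 ≤ K₁ * A t / δ t ^ (0 + 2 * (q + 1)) :=
    (norm_nonneg _).trans (hB t ht (x, s₀) hz)
  have h5 : K₁ * A t / δ t ^ (0 + 2 * (q + 1)) * |s₀ - s| ≤ K₁ * A t / δ t ^ (0 + 2 * q) := by
    rw [abs_sub_comm]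
    calc _ ≤ K₁ * A t / δ t ^ (0 + 2 * (q + 1)) * δ t ^ 2 := mul_le_mul_of_nonneg_left h2 hnn
      _ = _ := by
        have : δ t ^ (0 + 2 * (q + 1)) = δ t ^ (0 + 2 * q) * δ t ^ 2 := by ring
        rw [this]; field_simp
  have h8 := abs_sub_abs_le_abs_sub (timeD d u q (x, s₀)) (timeD d u q (x, s))
  have h9 : (K + K₁) * A t / δ t ^ (0 + 2 * q) =
    K * A t / δ t ^ (0 + 2 * q) + K₁ * A t / δ t ^ (0 + 2 * q) := by ring
  rw [h9]
  linarith

theorem step_space (d p q : ℕ) (r' r : ℝ) (hr : r' < r)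
    (u : EuclideanSpace ℝ (Fin d) × ℝ → ℝ) (hu : ContDiff ℝ ∞ u) (A δ : ℝ → ℝ)
    (hδ0 : ∀ t ≥ (1 : ℝ), 0 < δ t) (hδ1 : ∀ t ≥ (1 : ℝ), δ t ≤ 1)
    (hA : IntB d u A δ r 0 q) (hB : IntB d u A δ r (p + 1) q) :
    IntB d u A δ r' p q := by
  obtain ⟨K, hK, key⟩ := key_point d p 0 r' r hr
  obtain ⟨K₀, hK₀, hA⟩ := hA
  obtain ⟨K₁, hK₁, hB⟩ := hB
  have hrr : 0 < r - r' := by linarith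
  refine ⟨K * K₀ + K₁ * (r - r'), by positivity, ?_⟩
  rintro t ht ⟨x₀, s₀⟩ hz
  have hδ := hδ0 t ht
  refine opNorm_le_unit d p _ _ (fun v hv => ?_)
  obtain ⟨x, s, hxs, h1, h2, h3, hs, -⟩ :=
    key (timeD d u q) (contDiff_timeD d q hu) t (δ t) (K₀ * A t / δ t ^ (0 + 2 * q)) hδ (hδ1 t ht)
      (fun z hz => by rw [← norm_spaceTimeDeriv_zero]; exact hA t ht z hz) x₀ s₀ hz v hv
  have hs := hs rfl
  subst hs
  rw [spaceTimeDeriv_timeD] at h3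
  have hzr : (x₀, s) ∈ parabolicCylinder d r t := ⟨hz.1.trans hr.le, hz.2.1, hz.2.2⟩
  have hsm := contDiff_slice (contDiff_timeD d q hu) s
  have hm := Convex.norm_image_sub_le_of_norm_fderiv_le (𝕜 := ℝ)
    (s := Metric.closedBall (0 : EuclideanSpace ℝ (Fin d)) r) (x := x) (y := x₀)
    (f := iteratedFDeriv ℝ p (fun y => timeD d u q (y, s)))
    (C := K₁ * A t / δ t ^ (p + 1 + 2 * q))
    (fun y _ => (hsm.differentiable_iteratedFDeriv (by exact_mod_cast WithTop.coe_lt_top p)) y)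
    (fun y hy => by
      rw [norm_fderiv_iteratedFDeriv]
      exact hB t ht (y, s) ⟨by simpa using hy, hz.2.1, hz.2.2⟩) (convex_closedBall _ _)
    (by simpa using hxs.1) (by simpa using hzr.1)
  change ‖spaceTimeDeriv d u p q x₀ s - spaceTimeDeriv d u p q x s‖ ≤ _ at hm
  have h7 : |(spaceTimeDeriv d u p q x₀ s - spaceTimeDeriv d u p q x s) v| ≤
      ‖spaceTimeDeriv d u p q x₀ s - spaceTimeDeriv d u p q x s‖ := by
    refine ((spaceTimeDeriv d u p q x₀ s - spaceTimeDeriv d u p q x s).le_opNorm v).trans ?_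
    exact mul_le_of_le_one_right (norm_nonneg _)
      (Finset.prod_le_one (fun i _ => norm_nonneg _) (fun i _ => hv i))
  rw [ContinuousMultilinearMap.sub_apply] at h7
  have h8 := abs_sub_abs_le_abs_sub (spaceTimeDeriv d u p q x₀ s v)
    (spaceTimeDeriv d u p q x s v)
  have hnn : 0 ≤ K₁ * A t / δ t ^ (p + 1 + 2 * q) :=
    (norm_nonneg _).trans (hB t ht (x₀, s) hzr)
  have h5 : K₁ * A t / δ t ^ (p + 1 + 2 * q) * ‖x₀ - x‖ ≤
      K₁ * (r - r') * A t / δ t ^ (p + 2 * q) := by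
    rw [norm_sub_rev]
    calc _ ≤ K₁ * A t / δ t ^ (p + 1 + 2 * q) * ((r - r') * δ t) :=
          mul_le_mul_of_nonneg_left h1 hnn
      _ = _ := by
        have : δ t ^ (p + 1 + 2 * q) = δ t ^ (p + 2 * q) * δ t := by ring
        rw [this]; field_simp
  have h6 : K * (K₀ * A t / δ t ^ (0 + 2 * q)) / δ t ^ (p + 2 * 0) =
      K * K₀ * A t / δ t ^ (p + 2 * q) := by
    have : δ t ^ (p + 2 * q) = δ t ^ (0 + 2 * q) * δ t ^ (p + 2 * 0) := by ring
    rw [this]; field_simp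
  rw [h6] at h3
  have h9 : (K * K₀ + K₁ * (r - r')) * A t / δ t ^ (p + 2 * q) =
    K * K₀ * A t / δ t ^ (p + 2 * q) + K₁ * (r - r') * A t / δ t ^ (p + 2 * q) := by ring
  rw [h9]
  linarith

theorem interp_low (d m : ℕ) (r : ℝ)
    (u : EuclideanSpace ℝ (Fin d) × ℝ → ℝ) (hu : ContDiff ℝ ∞ u) (A δ : ℝ → ℝ)
    (hδ0 : ∀ t ≥ (1 : ℝ), 0 < δ t) (hδ1 : ∀ t ≥ (1 : ℝ), δ t ≤ 1)
    (hA : ∀ t ≥ (1 : ℝ), ∀ z ∈ parabolicCylinder d r t, |u z| ≤ A t)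
    (hT : ∀ p q, p + 2 * q = 2 * m → ∀ r' < r, IntB d u A δ r' p q) :
    ∀ p q, p + 2 * q ≤ 2 * m → ∀ r' < r, IntB d u A δ r' p q := by
  have ht : ∀ j q, q + j = m → ∀ r' < r, IntB d u A δ r' 0 q := by
    intro j
    induction j with
    | zero => intro q hq r' hr; exact hT 0 q (by omega) r' hr
    | succ j ih =>
      intro q hq r' hr
      exact step_time d q r' r hr u hu A δ hδ0 hδ1 hA (ih (q + 1) (by omega) r' hr)
  have hx : ∀ j p q, p + j + 2 * q = 2 * m → ∀ r' < r, IntB d u A δ r' p q := by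
    intro j
    induction j with
    | zero => intro p q hq r' hr; exact hT p q (by omega) r' hr
    | succ j ih =>
      intro p q hq r' hr
      exact step_space d p q r' ((r' + r) / 2) (by linarith) u hu A δ hδ0 hδ1
        (ht (m - q) q (by omega) _ (by linarith)) (ih (p + 1) q (by omega) _ (by linarith))
  intro p q h r' hr
  exact hx (2 * m - (p + 2 * q)) p q (by omega) r' hr

theorem frakDNorm_bound (d ℓ : ℕ) (r : ℝ)
    (u : EuclideanSpace ℝ (Fin d) × ℝ → ℝ) (A δ : ℝ → ℝ)
    (h : ∀ q ≤ ℓ / 2, IntB d u A δ r (ℓ - 2 * q) q) :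
    ∃ K > 0, ∀ t ≥ (1 : ℝ), ∀ z ∈ parabolicCylinder d r t,
      frakDNorm d u ℓ z ≤ K * (A t / δ t ^ ℓ) := by
  choose! K hK hB using h
  refine ⟨∑ q ∈ Finset.range (ℓ / 2 + 1), K q, ?_, ?_⟩
  · exact Finset.sum_pos (fun q hq => hK q (by simpa [Nat.lt_succ_iff] using hq)) (by simp)
  intro t ht z hz
  rw [Finset.sum_mul]
  have h1 : frakDNorm d u ℓ z ≤
      ∑ q ∈ Finset.range (ℓ / 2 + 1), ‖spaceTimeDeriv d u (ℓ - 2 * q) q z.1 z.2‖ := by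
    refine Real.sqrt_le_iff.mpr ⟨Finset.sum_nonneg (fun _ _ => norm_nonneg _), ?_⟩
    exact Finset.sum_sq_le_sq_sum_of_nonneg (fun _ _ => norm_nonneg _)
  refine h1.trans (Finset.sum_le_sum (fun q hq => ?_))
  have hq : q ≤ ℓ / 2 := by simpa [Nat.lt_succ_iff] using hq
  have := hB q hq t ht z hz
  rwa [show ℓ - 2 * q + 2 * q = ℓ by omega, mul_div_assoc] at this

theorem frakDHolder_comp (d p q : ℕ) (α B : ℝ) (u : EuclideanSpace ℝ (Fin d) × ℝ → ℝ)
    (Q : Set (EuclideanSpace ℝ (Fin d) × ℝ)) (h : frakDHolderLE d u (p + 2 * q) α Q B) :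
    ∀ z ∈ Q, ∀ w ∈ Q, ‖spaceTimeDeriv d u p q z.1 z.2 - spaceTimeDeriv d u p q w.1 w.2‖
        ≤ B * parabolicDist d z w ^ α := by
  obtain ⟨M, hM0, hMB, hM⟩ := h
  intro z hz w hw
  have hq : q ∈ Finset.range ((p + 2 * q) / 2 + 1) := by
    simp only [Finset.mem_range]; omega
  have h1 := hM q hq z hz w hw
  rw [show p + 2 * q - 2 * q = p by omega] at h1
  refine h1.trans (mul_le_mul_of_nonneg_right
    ((Finset.single_le_sum (fun i _ => hM0 i) hq).trans hMB) ?_)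
  apply Real.rpow_nonneg
  simp only [parabolicDist]; positivity

/-- The interpolation scale attached to the order `n`. -/
noncomputable def scl (α : ℝ) (n : ℕ) (t : ℝ) : ℝ :=
  Real.exp (-(t / 2) * (((n : ℝ) - 6 + α) / ((n : ℝ) + α)))

theorem scl_id (C₀ α : ℝ) (n ℓ : ℕ) (t : ℝ) :
    C₀ * Real.exp (-(6 + α) * t / 2) / scl α n t ^ ℓ =
      C₀ * Real.exp (-(t / 2) * (6 + α - (ℓ : ℝ) * ((n : ℝ) - 6 + α) / ((n : ℝ) + α))) := by
  rw [scl, ← Real.exp_nat_mul, mul_div_assoc, ← Real.exp_sub]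
  congr 2
  ring

theorem scl_top (C₀ α : ℝ) (hα : 0 < α) (n : ℕ) (t : ℝ) :
    C₀ * Real.exp (-(6 + α) * t / 2) / scl α n t ^ n / scl α n t ^ α =
      C₀ * Real.exp (((n : ℝ) - 12) * t / 2) := by
  rw [scl_id, scl, ← Real.exp_mul, mul_div_assoc, ← Real.exp_sub]
  congr 2
  have : (n : ℝ) + α ≠ 0 := by positivity
  field_simp
  ring

/-- Interpolation estimates for the third-order expansion coefficients
(estimate (5.12), part of Lemma 5.6 of the paper, in conditional form). -/
theorem interp_third_order_coefficients
    (d : ℕ) (hd : 1 ≤ d) (ρ ρ' : ℝ) (hρ' : 0 < ρ') (hρ : ρ' < ρ)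
    (α : ℝ) (hα0 : 0 < α) (hα1 : α < 1) (k : ℕ) (hk : 10 ≤ k) (C₀ : ℝ) (hC₀ : 0 < C₀)
    (u : EuclideanSpace ℝ (Fin d) × ℝ → ℝ) (hu : ContDiff ℝ (⊤ : ℕ∞) u)
    (h1 : ∀ t ≥ (1 : ℝ), ∀ z ∈ parabolicCylinder d ρ t, |u z| ≤ C₀ * Real.exp (-(6 + α) * t / 2))
    (h2 : ∀ t ≥ (1 : ℝ), frakDHolderLE d u 10 α (parabolicCylinder d ρ t) (C₀ * Real.exp (-t)))
    (h3 : ∀ t ≥ (1 : ℝ), ∀ ℓ : ℕ, 10 ≤ ℓ → ℓ ≤ 2 * k + 12 →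
      frakDHolderLE d u ℓ α (parabolicCylinder d ρ t)
        (C₀ * Real.exp (((ℓ : ℝ) - 12) * t / 2))) :
    ∃ C > 0, ∀ t ≥ (1 : ℝ),
      (∀ ℓ : ℕ, ℓ ≤ 10 → ∀ z ∈ parabolicCylinder d ρ' t,
        frakDNorm d u ℓ z ≤ C * Real.exp (-(t / 2) * (6 + α - (4 + α) * (ℓ : ℝ) / (10 + α)))) ∧
      (∀ ℓ : ℕ, 10 ≤ ℓ → ℓ ≤ 2 * k + 12 → ∀ z ∈ parabolicCylinder d ρ' t,
        frakDNorm d u ℓ z ≤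
          C * Real.exp (-(t / 2) * (6 + α - (ℓ : ℝ) * ((ℓ : ℝ) - 6 + α) / ((ℓ : ℝ) + α)))) := by
  have hu : ContDiff ℝ ∞ u := hu
  have hA0 : ∀ t ≥ (1 : ℝ), 0 < C₀ * Real.exp (-(6 + α) * t / 2) := fun t _ => by positivity
  have hδ0 : ∀ n, ∀ t ≥ (1 : ℝ), 0 < scl α n t := fun n t _ => Real.exp_pos _
  have hδ1 : ∀ n ≥ 10, ∀ t ≥ (1 : ℝ), scl α n t ≤ 1 := by
    intro n hn t ht
    have hn' : (10 : ℝ) ≤ n := by exact_mod_cast hn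
    apply Real.exp_le_one_iff.mpr
    have h : 0 ≤ ((n : ℝ) - 6 + α) / ((n : ℝ) + α) :=
      div_nonneg (by linarith) (by linarith)
    nlinarith
  have hT : ∀ n ≥ 10, n ≤ 2 * k + 12 → ∀ p q, p + 2 * q = n → ∀ r' < ρ,
      IntB d u (fun t => C₀ * Real.exp (-(6 + α) * t / 2)) (scl α n) r' p q := by
    intro n hn hnk p q hpq r' hr
    refine step_top d p q r' ρ α hr hα0 u hu _ _ hA0 (hδ0 n) (hδ1 n hn) h1 ?_
    intro t ht
    have h := h3 t ht n hn hnk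
    rw [← hpq] at h
    have h' := frakDHolder_comp d p q α _ u _ h
    rw [hpq] at h' ⊢
    rw [scl_top C₀ α hα0]
    exact h'
  have hlow : ∀ ℓ ≤ 10, ∃ K > 0, ∀ t ≥ (1 : ℝ), ∀ z ∈ parabolicCylinder d ρ' t,
      frakDNorm d u ℓ z ≤ K * (C₀ * Real.exp (-(6 + α) * t / 2) / scl α 10 t ^ ℓ) := by
    intro ℓ hℓ
    refine frakDNorm_bound d ℓ ρ' u (fun t => C₀ * Real.exp (-(6 + α) * t / 2)) (scl α 10) ?_
    intro q hq
    exact interp_low d 5 ρ u hu _ _ (hδ0 10) (hδ1 10 le_rfl) h1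
      (fun p q hpq r' hr => hT 10 le_rfl (by omega) p q (by omega) r' hr) _ _ (by omega) ρ' hρ
  have hhigh : ∀ ℓ, 10 ≤ ℓ → ℓ ≤ 2 * k + 12 → ∃ K > 0, ∀ t ≥ (1 : ℝ),
      ∀ z ∈ parabolicCylinder d ρ' t,
      frakDNorm d u ℓ z ≤ K * (C₀ * Real.exp (-(6 + α) * t / 2) / scl α ℓ t ^ ℓ) := by
    intro ℓ hℓ hℓk
    refine frakDNorm_bound d ℓ ρ' u (fun t => C₀ * Real.exp (-(6 + α) * t / 2)) (scl α ℓ) ?_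
    intro q hq
    exact hT ℓ hℓ hℓk _ _ (by omega) ρ' hρ
  choose! K hK hKb using hlow
  choose! K' hK' hKb' using hhigh
  set S : ℝ := ∑ ℓ ∈ Finset.range (2 * k + 13), (|K ℓ| + |K' ℓ|) with hS
  have hSle : ∀ ℓ ≤ 2 * k + 12, |K ℓ| + |K' ℓ| ≤ S := fun ℓ hℓ =>
    Finset.single_le_sum (f := fun ℓ => |K ℓ| + |K' ℓ|) (fun i _ => by positivity)
      (Finset.mem_range.mpr (by omega))
  have hS0 : 0 ≤ S := Finset.sum_nonneg (fun i _ => by positivity)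
  refine ⟨(S + 1) * C₀, by positivity, ?_⟩
  intro t ht
  constructor
  · intro ℓ hℓ z hz
    have h := hKb ℓ hℓ t ht z hz
    rw [scl_id] at h
    have e : (ℓ : ℝ) * (((10 : ℕ) : ℝ) - 6 + α) / (((10 : ℕ) : ℝ) + α) =
        (4 + α) * (ℓ : ℝ) / (10 + α) := by push_cast; ring
    rw [e] at h
    rw [mul_assoc]
    refine h.trans (mul_le_mul_of_nonneg_right ?_ (by positivity))
    have := hSle ℓ (by omega)
    linarith [le_abs_self (K ℓ), abs_nonneg (K' ℓ)]
  · intro ℓ hℓ hℓk z hz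
    have h := hKb' ℓ hℓ hℓk t ht z hz
    rw [scl_id] at h
    rw [mul_assoc]
    refine h.trans (mul_le_mul_of_nonneg_right ?_ (by positivity))
    have := hSle ℓ hℓk
    linarith [le_abs_self (K' ℓ), abs_nonneg (K ℓ)]
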